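/- arXiv:2508.17682 — 2 statements merged into one kernel-verified Lean document; each statement's English description precedes it below -/
import Mathlib

section
/- If G and H are finite simple graphs each having at most 7 vertices and X̄_G = X̄_H, then G and H are isomorphic. -/
/-- The Kromatic symmetric function of a simple graph `G`. -/
noncomputable def KSF {V : Type} (G : SimpleGraph V) : MvPowerSeries ℕ+ ℤ :=
  fun d => (Nat.card {κ : V → Finset ℕ+ //
    (∀ v, (κ v).Nonempty) ∧
    (∀ ⦃a b : V⦄, G.Adj a b → Disjoint (κ a) (κ b)) ∧
    (∀ i : ℕ+, Nat.card {v : V // i ∈ κ v} = d i)} : ℤ)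

section Invariant

open Finset

theorem KSF_eq_of_iso {V W : Type} {G : SimpleGraph V} {H : SimpleGraph W} (e : G ≃g H) :
    KSF G = KSF H := by
  funext d
  unfold KSF
  congr 1
  refine Nat.card_congr ((e.toEquiv.arrowCongr (Equiv.refl _)).subtypeEquiv fun κ => ?_)
  have h (v : V) : (e.toEquiv.arrowCongr (Equiv.refl (Finset ℕ+))) κ (e.toEquiv v) = κ v :=
    congrArg κ (e.toEquiv.symm_apply_apply v)
  refine and_congr (e.toEquiv.forall_congr fun v => by rw [h]) (and_congr ?_ ?_)
  · refine e.toEquiv.forall_congr fun {a} => e.toEquiv.forall_congr fun {b} => ?_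
    rw [h, h]
    exact imp_congr_left e.map_adj_iff.symm
  · refine forall_congr' fun i => ?_
    rw [Nat.card_congr (e.toEquiv.subtypeEquiv (q := fun w =>
      i ∈ (e.toEquiv.arrowCongr (Equiv.refl (Finset ℕ+))) κ w) fun v => by rw [h])]

open Classical in
/-- The number of independent subsets of `S`. -/
noncomputable def SimpleGraph.indepCount {V : Type} (G : SimpleGraph V) (S : Finset V) : ℕ :=
  #(S.powerset.filter fun A : Finset V => G.IsIndepSet (A : Set V))

/-- The sum of all coefficients of monomials in the variables of `C` in which every exponent is
at most `N`. -/
noncomputable def coeffSum (C : Finset ℕ+) (N : ℕ) (F : MvPowerSeries ℕ+ ℤ) : ℤ :=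
  ∑ d ∈ C.finsupp fun _ => range (N + 1), F d

section Coefficients

variable {V : Type} [Fintype V] (G : SimpleGraph V) (C : Finset ℕ+)

open Classical in
/-- The assignments of possibly empty subsets of `C` to the vertices such that adjacent vertices
receive disjoint sets. -/
noncomputable def weakColorings : Finset (V → Finset ℕ+) :=
  {κ ∈ Fintype.piFinset fun _ => C.powerset | ∀ ⦃a b : V⦄, G.Adj a b → Disjoint (κ a) (κ b)}

variable {G C} in
theorem mem_weakColorings {κ : V → Finset ℕ+} : κ ∈ weakColorings G C ↔
    (∀ v, κ v ⊆ C) ∧ ∀ ⦃a b : V⦄, G.Adj a b → Disjoint (κ a) (κ b) := by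
  simp [weakColorings]

open Classical in
theorem coeffSum_KSF {N : ℕ} (hN : Fintype.card V ≤ N) :
    coeffSum C N (KSF G) = #{κ ∈ weakColorings G C | ∀ v, (κ v).Nonempty} := by
  let content (κ : V → Finset ℕ+) : ℕ+ →₀ ℕ :=
    Finsupp.onFinset (univ.biUnion κ) (fun i => #{v | i ∈ κ v}) fun i hi => by
      obtain ⟨v, hv⟩ := card_ne_zero.1 hi
      exact mem_biUnion.2 ⟨v, mem_univ v, (mem_filter.1 hv).2⟩
  rw [card_eq_sum_card_fiberwise (f := content) (t := C.finsupp fun _ => range (N + 1)),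
    coeffSum, Nat.cast_sum]
  · refine sum_congr rfl fun d hd => ?_
    rw [mem_finsupp_iff] at hd
    unfold KSF
    rw [Nat.subtype_card]
    intro κ
    have hc : content κ = d ↔ ∀ i : ℕ+, Nat.card {v : V // i ∈ κ v} = d i := by
      simp [content, Finsupp.ext_iff, Fintype.card_subtype]
    rw [mem_filter, mem_filter, mem_weakColorings, hc]
    constructor
    · tauto
    · rintro ⟨h₁, h₂, h₃⟩
      refine ⟨⟨⟨fun v i hi => hd.1 ?_, h₂⟩, h₁⟩, h₃⟩
      rw [Finsupp.mem_support_iff, ← h₃ i]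
      exact Nat.card_ne_zero.2 ⟨⟨v, hi⟩, inferInstance⟩
  · intro κ hκ
    simp only [coe_filter, mem_weakColorings, Set.mem_ofPred_eq] at hκ
    rw [mem_coe, mem_finsupp_iff]
    refine ⟨fun i hi => ?_, fun i _ => ?_⟩
    · obtain ⟨v, -, hv⟩ := mem_biUnion.1 (Finsupp.support_onFinset_subset hi)
      exact hκ.1.1 v hv
    · exact mem_range.2 (Nat.lt_succ_of_le ((card_le_univ _).trans hN))

open Classical in
theorem card_weakColorings_empty_on [DecidableEq V] (T : Finset V) :
    #{κ ∈ weakColorings G C | ∀ v ∈ T, κ v = ∅} = G.indepCount Tᶜ ^ #C := by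
  rw [SimpleGraph.indepCount, ← Fintype.card_coe C, ← card_univ (α := C), ← prod_const,
    ← Fintype.card_piFinset]
  refine card_bij' (fun κ _ c => {v | c.1 ∈ κ v})
    (fun A _ v => (univ.filter fun c => v ∈ A c).map (Function.Embedding.subtype _)) ?_ ?_ ?_ ?_
  · intro κ hκ
    simp only [mem_filter, mem_weakColorings] at hκ
    simp only [Fintype.mem_piFinset, mem_filter, mem_powerset, subset_iff, mem_compl]
    refine fun c => ⟨fun v hv hT => ?_, fun a ha b hb _ hab => ?_⟩
    · simp [hκ.2 v hT] at hv
    · exact disjoint_left.1 (hκ.1.2 hab) (by simpa using ha) (by simpa using hb)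
  · intro A hA
    simp only [Fintype.mem_piFinset, mem_filter, mem_powerset, subset_iff, mem_compl] at hA
    simp only [mem_filter, mem_weakColorings]
    refine ⟨⟨fun v c hc => ?_, fun a b hab => disjoint_left.2 fun c ha hb => ?_⟩, fun v hv => ?_⟩
    · obtain ⟨c, -, rfl⟩ := mem_map.1 hc
      exact c.2
    · simp only [mem_map, mem_filter, mem_univ, true_and, Function.Embedding.subtype_apply] at ha hb
      obtain ⟨c, ha, rfl⟩ := ha
      obtain ⟨c', hb, hc⟩ := hb
      rw [Subtype.ext hc] at hb
      exact (hA c).2 ha hb hab.ne hab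
    · simp only [map_eq_empty, filter_eq_empty_iff]
      exact fun c _ hc => (hA c).1 hc hv
  · intro κ hκ
    simp only [mem_filter, mem_weakColorings] at hκ
    ext v c
    simpa using fun hc => hκ.1.1 v hc
  · intro A _
    ext c v
    simp

open Classical in
theorem coeffSum_KSF_eq_alternating_sum [DecidableEq V] {N : ℕ} (hN : Fintype.card V ≤ N) :
    coeffSum C N (KSF G) = ∑ T : Finset V, (-1) ^ #T * (G.indepCount Tᶜ : ℤ) ^ #C := by
  rw [coeffSum_KSF G C hN]
  simp_rw [← Nat.cast_pow, ← card_weakColorings_empty_on, card_filter _ (weakColorings G C),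
    Nat.cast_sum, mul_sum]
  rw [sum_comm]
  refine sum_congr rfl fun κ _ => ?_
  have h : ∀ T : Finset V, (∀ v ∈ T, κ v = ∅) ↔ T ∈ (univ.filter fun v => κ v = ∅).powerset := by
    simp [subset_iff]
  simp_rw [h, Nat.cast_ite, Nat.cast_one, Nat.cast_zero, mul_ite, mul_one, mul_zero]
  rw [← sum_filter, filter_mem_eq_inter, univ_inter, sum_powerset_neg_one_pow_card]
  simp [filter_eq_empty_iff, nonempty_iff_ne_empty]

end Coefficients

/-- A function on the subsets of `{0, …, v - 1}`, stored as a binary tree of depth `v` which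
branches first on membership of `v - 1`: the left subtree holds the subsets without `v - 1`. -/
inductive SubsetTree
  | leaf (a : ℕ)
  | node (l r : SubsetTree)

namespace SubsetTree

/-- The tree of the function `F` on the subsets of `{0, …, v - 1}`. -/
def ofFun : ℕ → (Finset ℕ → ℕ) → SubsetTree
  | 0, F => leaf (F ∅)
  | v + 1, F => node (ofFun v F) (ofFun v fun S => F (insert v S))

/-- The tree of the function with value `F S + G (S ∖ N)` at `S`, given the trees of `F` and `G`,
where the list tells which elements, in decreasing order, belong to `N`. This and the following
functions are written with recursors to speed up their evaluation in the kernel. -/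
noncomputable def addSdiff (N : List Bool) : SubsetTree → SubsetTree → SubsetTree :=
  List.rec
    (fun t t' => SubsetTree.rec
      (fun a => SubsetTree.rec (fun a' => leaf (Nat.add a a')) (fun _ _ _ _ => t) t')
      (fun _ _ _ _ => t) t)
    (fun b _ ih t t' => SubsetTree.rec (fun _ => t)
      (fun l r _ _ => SubsetTree.rec (fun _ => t)
        (fun l' r' _ _ => node (ih l l') (ih r (Bool.rec r' l' b))) t') t) N

/-- The sum of the `k`-th powers of all entries, weighted by a factor `m` for every element missing
from the subset. -/
noncomputable def powerSum (m k : ℕ) : SubsetTree → ℕ :=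
  SubsetTree.rec (fun a => Nat.pow a k) fun _ _ l r => Nat.add r (Nat.mul m l)

/-- The list `[p (v - 1), …, p 0]`. -/
def descendingList (p : ℕ → Bool) : ℕ → List Bool
  | 0 => []
  | v + 1 => p v :: descendingList p v

theorem ofFun_congr {v : ℕ} {F F' : Finset ℕ → ℕ} (h : ∀ S ⊆ range v, F S = F' S) :
    ofFun v F = ofFun v F' := by
  induction v generalizing F F' with
  | zero => simp [ofFun, h ∅ (by simp)]
  | succ v ih =>
    rw [ofFun, ofFun, ih fun S hS => h S (hS.trans (range_subset_range.2 v.le_succ)),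
      ih fun S hS => h _ ?_]
    rw [range_add_one]
    exact insert_subset_insert v hS

theorem addSdiff_ofFun (p : ℕ → Bool) (v : ℕ) (F F' : Finset ℕ → ℕ) :
    addSdiff (descendingList p v) (ofFun v F) (ofFun v F') =
      ofFun v fun S => F S + F' {i ∈ S | ¬p i} := by
  induction v generalizing F F' with
  | zero => rfl
  | succ v ih =>
    cases hp : p v with
    | false =>
      have h : addSdiff (descendingList p (v + 1)) (ofFun (v + 1) F) (ofFun (v + 1) F') =
          node (addSdiff (descendingList p v) (ofFun v F) (ofFun v F'))
            (addSdiff (descendingList p v) (ofFun v fun S => F (insert v S))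
              (ofFun v fun S => F' (insert v S))) := by
        simp [descendingList, addSdiff, hp, ofFun]
      rw [h, ih, ih]
      simp [ofFun, filter_insert, hp]
    | true =>
      have h : addSdiff (descendingList p (v + 1)) (ofFun (v + 1) F) (ofFun (v + 1) F') =
          node (addSdiff (descendingList p v) (ofFun v F) (ofFun v F'))
            (addSdiff (descendingList p v) (ofFun v fun S => F (insert v S)) (ofFun v F')) := by
        simp [descendingList, addSdiff, hp, ofFun]
      rw [h, ih, ih]
      simp [ofFun, filter_insert, hp]

theorem cast_powerSum_ofFun {m M : ℕ} (hm : (m : ZMod M) = -1) (k v : ℕ) (F : Finset ℕ → ℕ) :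
    (powerSum m k (ofFun v F) : ZMod M) =
      ∑ S ∈ (range v).powerset, (-1) ^ (v - #S) * (F S : ZMod M) ^ k := by
  induction v generalizing F with
  | zero => simp [ofFun, powerSum]
  | succ v ih =>
    have h : powerSum m k (ofFun (v + 1) F) = powerSum m k (ofFun v fun S => F (insert v S)) +
      m * powerSum m k (ofFun v F) := rfl
    rw [h, Nat.cast_add, Nat.cast_mul, hm, ih, ih, range_add_one,
      sum_powerset_insert notMem_range_self, add_comm, mul_sum]
    refine congrArg₂ _ (sum_congr rfl fun S hS => ?_) (sum_congr rfl fun S hS => ?_)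
    · have hc := card_le_card (mem_powerset.1 hS)
      rw [card_range] at hc
      rw [Nat.succ_sub hc, pow_succ]
      ring
    · rw [card_insert_of_notMem fun hv => notMem_range_self (mem_powerset.1 hS hv),
        Nat.add_sub_add_right]

end SubsetTree

theorem powerset_map {α β : Type*} (f : α ↪ β) (s : Finset α) :
    (s.map f).powerset = s.powerset.map (mapEmbedding f).toEmbedding := by
  ext t
  simp [subset_map_iff, eq_comm]

namespace SimpleGraph

theorem indepCount_comap {V W : Type} (G : SimpleGraph W) (f : V ↪ W) (S : Finset V) :
    (G.comap f).indepCount S = G.indepCount (S.map f) := by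
  classical
  unfold indepCount
  rw [powerset_map, filter_map, card_map]
  congr 1
  refine filter_congr fun A _ => ?_
  simp only [Function.comp_apply, RelEmbedding.coe_toEmbedding, mapEmbedding_apply, coe_map,
    IsIndepSet]
  rw [f.injective.injOn.pairwise_image]
  rfl

theorem indepCount_empty {V : Type} (G : SimpleGraph V) : G.indepCount ∅ = 1 := by
  simp [indepCount, filter_singleton]

theorem indepCount_insert {V : Type} [DecidableEq V] (G : SimpleGraph V) [DecidableRel G.Adj]
    {v : V} {S : Finset V} (hv : v ∉ S) :
    G.indepCount (insert v S) = G.indepCount S + G.indepCount {i ∈ S | ¬G.Adj v i} := by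
  classical
  have h : ∑ A ∈ S.powerset, (if G.IsIndepSet (↑(insert v A) : Set V) then 1 else 0) =
      G.indepCount {i ∈ S | ¬G.Adj v i} := by
    rw [indepCount, ← card_filter]
    congr 1
    ext A
    simp only [mem_filter, mem_powerset, coe_insert, IsIndepSet, subset_iff]
    have : Std.Symm fun v w => ¬G.Adj v w := ⟨fun _ _ h h' => h h'.symm⟩
    rw [Set.pairwise_insert_of_symm]
    constructor
    · rintro ⟨h₁, h₂, h₃⟩
      exact ⟨fun a ha => ⟨h₁ ha, h₃ a ha fun h => hv (h ▸ h₁ ha)⟩, h₂⟩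
    · rintro ⟨h₁, h₂⟩
      exact ⟨fun a ha => (h₁ ha).1, h₂, fun a ha _ => (h₁ ha).2⟩
  rw [← h, indepCount, indepCount, card_filter, card_filter, sum_powerset_insert hv]
  congr!

/-- The graph on `ℕ` in which `i < j` are adjacent if the binary digit of `c` at position
`j * (j - 1) / 2 + i` is one. -/
def ofCode (c : ℕ) : SimpleGraph ℕ :=
  fromRel fun i j => i < j ∧ c.testBit (j * (j - 1) / 2 + i)

theorem ofCode_adj {c i j : ℕ} (h : i < j) :
    (ofCode c).Adj j i ↔ c.testBit (j * (j - 1) / 2 + i) = true := by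
  simp [ofCode, h, h.ne', h.not_gt]

end SimpleGraph

open SubsetTree

/-- The numbers of independent subsets of all sets of vertices less than `v` in the graph with
code `c`. -/
noncomputable def indepTree (c v : ℕ) : SubsetTree :=
  Nat.rec (leaf 1) (fun v t =>
    node t (addSdiff (descendingList (fun i => c.testBit (v * (v - 1) / 2 + i)) v) t t)) v

theorem indepTree_eq_ofFun (c v : ℕ) :
    indepTree c v = ofFun v (SimpleGraph.ofCode c).indepCount := by
  classical
  induction v with
  | zero => simp [indepTree, ofFun, SimpleGraph.indepCount_empty]
  | succ v ih =>
    change node (indepTree c v) (addSdiff _ (indepTree c v) (indepTree c v)) = _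
    rw [ih, addSdiff_ofFun, ofFun]
    congr 1
    refine ofFun_congr fun S hS => ?_
    rw [SimpleGraph.indepCount_insert _ fun h => notMem_range_self (hS h)]
    congr 2
    refine filter_congr fun i hi => ?_
    rw [SimpleGraph.ofCode_adj (mem_range.1 (hS hi))]

/-- The graph on `n` vertices with code `c`. -/
def codedGraph (n c : ℕ) : SimpleGraph (Fin n) :=
  (SimpleGraph.ofCode c).comap Fin.valEmbedding

/-- The sum of the coefficients of monomials in the first eight variables with exponents
at most 7. -/
noncomputable def coverCount (F : MvPowerSeries ℕ+ ℤ) : ℤ :=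
  coeffSum (Finset.Icc 1 8) 7 F

theorem coverCount_KSF_codedGraph {n : ℕ} (hn : n ≤ 7) (c : ℕ) :
    coverCount (KSF (codedGraph n c)) =
      ∑ S ∈ (range n).powerset, (-1) ^ (n - #S) * ((SimpleGraph.ofCode c).indepCount S : ℤ) ^ 8 := by
  rw [coverCount, coeffSum_KSF_eq_alternating_sum _ _ (by simpa using hn)]
  have h : #(Finset.Icc (1 : ℕ+) 8) = 8 := rfl
  rw [h, ← Nat.Iio_eq_range, ← Fin.map_valEmbedding_univ, powerset_map, sum_map, powerset_univ,
    ← (Equiv.refl _).sum_comp, ← Equiv.sum_comp (Function.Involutive.toPerm _ compl_involutive)]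
  refine sum_congr rfl fun T _ => ?_
  simp only [Function.Involutive.coe_toPerm, card_compl, Fintype.card_fin,
    Equiv.refl_apply, RelEmbedding.coe_toEmbedding, mapEmbedding_apply, card_map]
  rw [codedGraph, SimpleGraph.indepCount_comap, compl_compl]

/-- The remainder modulo `2 ^ 64` of `coverCount` for the graph on `x % 8` vertices with code
`x / 8`. -/
noncomputable def coverCountMod (x : ℕ) : ℕ :=
  Nat.mod (powerSum 18446744073709551615 8 (indepTree (x / 8) (x % 8))) 18446744073709551616

theorem cast_coverCountMod (x : ℕ) : (coverCountMod x : ZMod 18446744073709551616) =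
    coverCount (KSF (codedGraph (x % 8) (x / 8))) := by
  have h : coverCountMod x = powerSum 18446744073709551615 8 (indepTree (x / 8) (x % 8)) %
      18446744073709551616 := rfl
  rw [coverCount_KSF_codedGraph (Nat.le_of_lt_succ (Nat.mod_lt x (by norm_num))), h,
    ZMod.natCast_mod, indepTree_eq_ofFun, cast_powerSum_ofFun]
  · simp
  · rfl

section Burnside

open Equiv MulAction

/-- Relabelling of the vertices. -/
instance SimpleGraph.permMulAction (n : ℕ) : MulAction (Perm (Fin n)) (SimpleGraph (Fin n)) where
  smul σ G := G.comap ⇑σ⁻¹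
  one_smul _ := rfl
  mul_smul _ _ _ := rfl

theorem SimpleGraph.perm_smul_adj {n : ℕ} (σ : Perm (Fin n)) (G : SimpleGraph (Fin n))
    (i j : Fin n) : (σ • G).Adj i j ↔ G.Adj (σ⁻¹ i) (σ⁻¹ j) := Iff.rfl

theorem SimpleGraph.nonempty_iso_of_orbitRel {n : ℕ} {G H : SimpleGraph (Fin n)}
    (h : orbitRel (Perm (Fin n)) _ G H) : Nonempty (G ≃g H) := by
  obtain ⟨σ, rfl⟩ := h
  exact ⟨⟨σ⁻¹, Iff.rfl⟩⟩

/-- A number encoding the unordered pair of `i` and `j`. -/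
def pairWeight {n : ℕ} (i j : Fin n) : ℕ := n * min i.1 j.1 + max i.1 j.1

theorem pairWeight_comm {n : ℕ} (i j : Fin n) : pairWeight i j = pairWeight j i := by
  rw [pairWeight, min_comm, max_comm, pairWeight]

/-- The pairs `i < j` whose weight does not decrease under the first powers of `σ`. -/
def minimalPairs {n : ℕ} (σ : Perm (Fin n)) : Finset (Fin n × Fin n) :=
  {p | p.1 < p.2 ∧ ∀ k ∈ range 12, pairWeight p.1 p.2 ≤ pairWeight ((σ ^ k) p.1) ((σ ^ k) p.2)}

theorem exists_pow_mem_minimalPairs {n : ℕ} (σ : Perm (Fin n)) {i j : Fin n} (hij : i ≠ j) :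
    ∃ k : ℕ, ((σ ^ k) i, (σ ^ k) j) ∈ minimalPairs σ ∨ ((σ ^ k) j, (σ ^ k) i) ∈ minimalPairs σ := by
  obtain ⟨k, hk⟩ := exists_minimalFor_of_wellFoundedLT (fun _ : ℕ => True)
    (fun k => pairWeight ((σ ^ k) i) ((σ ^ k) j)) ⟨0, trivial⟩
  have hmin (l : ℕ) : pairWeight ((σ ^ k) i) ((σ ^ k) j) ≤
      pairWeight ((σ ^ l) ((σ ^ k) i)) ((σ ^ l) ((σ ^ k) j)) := by
    rw [← Perm.mul_apply, ← Perm.mul_apply, ← pow_add]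
    exact (le_total _ _).elim id fun h => hk.2 trivial h
  refine ⟨k, ?_⟩
  simp only [minimalPairs, mem_filter, mem_univ, true_and]
  rcases lt_or_gt_of_ne ((σ ^ k).injective.ne hij) with h | h
  · exact Or.inl ⟨h, fun l _ => hmin l⟩
  · refine Or.inr ⟨h, fun l _ => ?_⟩
    rw [pairWeight_comm, pairWeight_comm ((σ ^ l) _)]
    exact hmin l

theorem SimpleGraph.adj_pow_apply_of_mem_fixedBy {n : ℕ} {σ : Perm (Fin n)}
    {G : SimpleGraph (Fin n)} (hG : G ∈ fixedBy (SimpleGraph (Fin n)) σ) (k : ℕ) (i j : Fin n) :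
    G.Adj ((σ ^ k) i) ((σ ^ k) j) ↔ G.Adj i j := by
  have hk : σ ^ k ∈ stabilizer (Perm (Fin n)) G := pow_mem hG k
  conv_lhs => rw [← mem_stabilizer_iff.1 hk, perm_smul_adj]
  simp

theorem card_fixedBy_le {n : ℕ} (σ : Perm (Fin n)) :
    Nat.card (fixedBy (SimpleGraph (Fin n)) σ) ≤ 2 ^ #(minimalPairs σ) := by
  classical
  rw [← card_powerset, ← Fintype.card_coe, ← Nat.card_eq_fintype_card]
  refine Nat.card_le_card_of_injective
    (fun G => ⟨{p ∈ minimalPairs σ | G.1.Adj p.1 p.2}, mem_powerset.2 (filter_subset _ _)⟩) ?_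
  intro ⟨G, hG⟩ ⟨H, hH⟩ h
  simp only [Subtype.mk.injEq, filter_inj'] at h
  ext i j
  rcases eq_or_ne i j with rfl | hij
  · simp
  obtain ⟨k, hk | hk⟩ := exists_pow_mem_minimalPairs σ hij
  · simpa [SimpleGraph.adj_pow_apply_of_mem_fixedBy hG,
      SimpleGraph.adj_pow_apply_of_mem_fixedBy hH] using h hk
  · simpa [SimpleGraph.adj_pow_apply_of_mem_fixedBy hG,
      SimpleGraph.adj_pow_apply_of_mem_fixedBy hH, SimpleGraph.adj_comm _ j] using h hk

theorem card_fixedBy_eq_of_isConj {n : ℕ} {σ τ : Perm (Fin n)} (h : IsConj σ τ) :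
    Nat.card (fixedBy (SimpleGraph (Fin n)) σ) = Nat.card (fixedBy (SimpleGraph (Fin n)) τ) := by
  obtain ⟨g, rfl⟩ := isConj_iff.1 h
  rw [← smul_fixedBy]
  exact (Nat.card_congr (Equiv.Set.image _ _ (MulAction.injective g)))

/-- The product of cycles of the given lengths on consecutive blocks of a list. -/
def blockCycles {n : ℕ} : List (Fin n) → List ℕ → Perm (Fin n)
  | _, [] => 1
  | L, a :: l => (L.take a).formPerm * blockCycles (L.drop a) l

/-- The lengths of the nontrivial cycles for all conjugacy classes of permutations of `n` points,
where `n ≤ 7`. -/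
def cycleLengths (n : ℕ) : List (List ℕ) :=
  [[], [2], [3], [4], [5], [6], [7], [2, 2], [2, 3], [2, 4], [2, 5], [3, 3], [3, 4], [2, 2, 2],
    [2, 2, 3]].filter (List.sum · ≤ n)

/-- The size of a conjugacy class of permutations. -/
def classCard (n : ℕ) (m : Multiset ℕ) : ℕ :=
  n.factorial / ((n - m.sum).factorial * m.prod * ∏ i ∈ m.toFinset, (m.count i).factorial)

/-- The number of graphs on `n` vertices up to isomorphism, for `n ≤ 7`. -/
def graphCount (n : ℕ) : ℕ := [1, 1, 2, 4, 11, 34, 156, 1044].getD n 0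

theorem cycleType_blockCycles : ∀ n ∈ range 8, ∀ l ∈ cycleLengths n,
    (blockCycles (List.finRange n) l).cycleType = l := by
  decide +kernel

theorem nodup_cycleLengths : ∀ n ∈ range 8,
    ((cycleLengths n).map ((↑) : List ℕ → Multiset ℕ)).Nodup := by
  decide +kernel

theorem sum_classCard : ∀ n ∈ range 8,
    ((cycleLengths n).map fun l : List ℕ => classCard n l).sum = n.factorial := by
  decide +kernel

theorem sum_classCard_mul : ∀ n ∈ range 8, ((cycleLengths n).map fun l : List ℕ =>
    classCard n l * 2 ^ #(minimalPairs (blockCycles (List.finRange n) l))).sum =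
      graphCount n * n.factorial := by
  decide +kernel

theorem card_cycleType_eq {n : ℕ} (hn : n ∈ range 8) {l : List ℕ} (hl : l ∈ cycleLengths n) :
    #{σ : Perm (Fin n) | σ.cycleType = l} = classCard n l := by
  have h := Perm.card_of_cycleType (Fin n) (l : Multiset ℕ)
  rwa [Fintype.card_fin, if_pos] at h
  have := (Perm.exists_with_cycleType_iff (Fin n)).1 ⟨_, cycleType_blockCycles n hn l hl⟩
  rwa [Fintype.card_fin] at this

theorem cycleType_mem_cycleLengths {n : ℕ} (hn : n ∈ range 8) (σ : Perm (Fin n)) :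
    σ.cycleType ∈ ((cycleLengths n).map ((↑) : List ℕ → Multiset ℕ)).toFinset := by
  set T := ((cycleLengths n).map ((↑) : List ℕ → Multiset ℕ)).toFinset with hT
  have h : #{σ : Perm (Fin n) | σ.cycleType ∈ T} = Fintype.card (Perm (Fin n)) := by
    rw [card_eq_sum_card_fiberwise (f := Perm.cycleType) (t := T) fun σ hσ => by simpa using hσ,
      Fintype.card_perm, Fintype.card_fin, ← sum_classCard n hn, hT,
      List.sum_toFinset _ (nodup_cycleLengths n hn), List.map_map]
    congr 1
    refine List.map_congr_left fun l hl => ?_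
    rw [Function.comp_apply, ← card_cycleType_eq hn hl, filter_filter]
    congr 1
    refine filter_congr fun σ _ => and_iff_right_of_imp fun h => ?_
    rw [h, List.mem_toFinset]
    exact List.mem_map_of_mem hl
  have := (card_eq_iff_eq_univ _).1 h
  simpa using this.ge (mem_univ σ)

/-- By Burnside's lemma, `graphCount n` bounds the number of graphs on `n` vertices up to
isomorphism. -/
theorem card_orbits_le {n : ℕ} (hn : n ∈ range 8) :
    Nat.card (Quotient (orbitRel (Perm (Fin n)) (SimpleGraph (Fin n)))) ≤ graphCount n := by
  classical
  have : ∀ σ : Perm (Fin n), Fintype (fixedBy (SimpleGraph (Fin n)) σ) :=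
    fun _ => Fintype.ofFinite _
  have : Fintype (Quotient (orbitRel (Perm (Fin n)) (SimpleGraph (Fin n)))) := Fintype.ofFinite _
  have h := sum_card_fixedBy_eq_card_orbits_mul_card_group (Perm (Fin n)) (SimpleGraph (Fin n))
  rw [Fintype.card_perm, Fintype.card_fin] at h
  refine Nat.le_of_mul_le_mul_right ?_ n.factorial_pos
  rw [Nat.card_eq_fintype_card, ← h, ← sum_classCard_mul n hn,
    ← sum_fiberwise_of_maps_to (g := Perm.cycleType) fun σ _ => cycleType_mem_cycleLengths hn σ,
    List.sum_toFinset _ (nodup_cycleLengths n hn), List.map_map]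
  refine List.sum_le_sum fun l hl => ?_
  rw [Function.comp_apply, ← card_cycleType_eq hn hl, ← smul_eq_mul]
  refine sum_le_card_nsmul _ _ _ fun σ hσ => ?_
  rw [← Nat.card_eq_fintype_card, card_fixedBy_eq_of_isConj (Perm.isConj_iff_cycleType_eq.2
    ((mem_filter.1 hσ).2.trans (cycleType_blockCycles n hn l hl).symm))]
  exact card_fixedBy_le _

end Burnside

/-- One graph from each isomorphism class of graphs on at most 7 vertices, where `8 * c + n` stands
for `codedGraph n c`, in the order of `coverCount`. -/
def representatives : List ℕ :=
  [0, 1, 10, 59, 2, 508, 16777215, 51, 8189, 262142, 500, 16777207, 8181, 262134, 19, 16777175,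
   468, 244, 16776951, 262102, 8149, 16777047, 7925, 261878, 16776919, 16777159, 340, 261974,
   212, 16773079, 261846, 8021, 16776023, 3, 7893, 16776855, 258006, 262086, 16645879, 4053,
   16774871, 452, 16772823, 8133, 16776903, 130806, 260950, 261782, 16645975, 148, 16759639,
   16642007, 259798, 7829, 6997, 16645847, 257750, 5845, 16772759, 16742103, 3797, 261830,
   130902, 16772311, 16773063, 16758487, 126934, 8384471, 130774, 16774855, 16707287, 16775879,
   16740055, 196, 7877, 244566, 8387415, 16235351, 16641751, 16776775, 16645783, 257686,
   16771735, 16772807, 8257367, 257990, 227030, 257238, 243414, 8386263, 16707223, 3733, 8257239,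
   4037, 192214, 15693527, 224982, 16756375, 8384215, 3285, 16739991, 259782, 16217815, 126678,
   260806, 16645831, 130710, 16641239, 16742087, 16641687, 16641991, 14610135, 16771783,
   16758471, 16182999, 16633559, 15691479, 257734, 256662, 16767687, 261702, 15658711, 16774727,
   5829, 6853, 12447447, 16772679, 16706199, 14544599, 16740039, 192150, 8351447, 16756423,
   8384151, 241302, 3781, 16707271, 224918, 16640663, 8257175, 2709, 130758, 8253143, 14610071,
   8383703, 8384455, 126166, 126614, 16770759, 16625303, 126918, 16608919, 16641735, 7749,
   16182935, 118486, 15658647, 227014, 256710, 8386247, 15693511, 68, 243398, 16215703, 8387271,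
   12446935, 252614, 16217799, 14544535, 16234183, 16739015, 15592663, 16689815, 12447383,
   12447687, 8257223, 16776711, 14544087, 16772167, 16117399, 16763591, 15593111, 16496327,
   224966, 16640711, 16645703, 16741959, 259654, 16758343, 191126, 8383127, 241350, 8244951,
   8384199, 192198, 257606, 8253079, 8252631, 16607895, 16608967, 2757, 125590, 16739911,
   8253383, 16625351, 14609047, 16707143, 15691463, 16773703, 16181911, 7990999, 126662,
   16232135, 110230, 93846, 16215751, 16764487, 14610119, 15658695, 255686, 16494279, 16182983,
   12446359, 16770631, 14543511, 16737991, 16643655, 15592087, 15593159, 16576455, 14528151,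
   16639687, 14511767, 16117447, 12447431, 16641607, 8317591, 5701, 8351431, 16607943, 8236695,
   3653, 8220311, 8367815, 15576727, 14544583, 16632519, 8252055, 223942, 16599703, 8383175,
   6155927, 248518, 174742, 130630, 7728791, 7204055, 15690439, 7204503, 125638, 8253127,
   16772615, 257094, 14592663, 16214727, 1733, 16739399, 16501447, 16706631, 15693383, 16476871,
   93894, 92822, 16217671, 110278, 8386119, 16576199, 15592135, 226886, 261638, 16116423, 243270,
   12446407, 6156231, 16627271, 16378567, 14019223, 8384071, 16641095, 15560391, 224838,
   15691335, 192070, 16740935, 14609991, 16215623, 16608839, 12413591, 15658567, 15576775,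
   16084679, 14543559, 249414, 8257095, 7793303, 12414663, 16623303, 61382, 16363207, 16633415,
   258630, 8350407, 16477767, 8219287, 16444999, 12431047, 8220359, 6139543, 16737863, 8374983,
   16770119, 16723527, 8236743, 6154903, 16705095, 222918, 8252103, 8382151, 15689415, 255558,
   128582, 7696023, 7958167, 7203479, 124614, 7204551, 126534, 15595079, 3141, 16575175,
   16639559, 16119367, 14068375, 7728839, 15591111, 92870, 12445383, 15593031, 6155975, 4062919,
   16698439, 117446, 15559367, 12449351, 8351303, 16115399, 14544455, 84630, 16083655, 14542535,
   12413639, 12447303, 16379463, 15583943, 16608327, 16610887, 16108231, 16345799, 12438215,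
   16707079, 16739847, 8211095, 61126, 8255047, 7685, 8383559, 15690823, 8219335, 11365015,
   11366087, 7826119, 16215111, 224326, 14609479, 8243911, 16645639, 8349383, 16576071, 191558,
   15658055, 8252999, 8088263, 16444487, 11890375, 16770567, 6122135, 16566983, 8251079, 7203527,
   7727815, 257542, 12168903, 4677, 15578695, 14479047, 7989959, 112198, 7957143, 126022,
   15692359, 16723015, 16216647, 8187591, 6123207, 1605, 15592519, 16623175, 6139591, 93766,
   6154951, 15560263, 12446791, 14543943, 16084551, 8385095, 7827015, 118342, 108230, 14511687,
   16631367, 16724551, 15574727, 8238663, 15584839, 15689287, 225862, 16737351, 12428999,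
   16346695, 15674951, 14536263, 4058823, 15656519, 14607943, 11365063, 12414535, 16639047,
   8382023, 8220231, 8350791, 15134279, 16180807, 14526151, 16641543, 8318023, 60102, 4,
   16575559, 222790, 208454, 7206471, 12151495, 7730759, 190022, 8244807, 15590983, 255046,
   8234695, 16672327, 8334919, 7695047, 16115271, 12445255, 14542407, 8252487, 12380871, 6113943,
   124486, 7204423, 7195335, 16688711, 7202503, 7957191, 6155847, 8186567, 14601287, 15649863,
   7990855, 16377415, 7726791, 183366, 6122183, 6153927, 16606791, 8352327, 16591943, 15562311,
   6146759, 15559751, 14609927, 16086599, 16084039, 16574023, 93254, 15658503, 95814, 4057799,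
   16215559, 14511175, 15068743, 7663303, 12414023, 8222279, 8349255, 7190087, 14281799, 8316487,
   7302727, 3589, 8384007, 60998, 14478919, 16608775, 16705031, 15527495, 130566, 4062791,
   16754183, 7826503, 11365959, 8250951, 11904711, 8219719, 51910, 11890247, 7269447, 7695943,
   8055879, 192006, 8187463, 16622663, 224774, 8178375, 6123079, 12166855, 16313927, 15674439,
   12152391, 15574599, 7958087, 7186119, 5589655, 16098887, 6147655, 14264007, 7203911, 8257031,
   15133767, 6155335, 14526023, 7300807, 16639495, 15675975, 5597895, 12428871, 7828039, 207942,
   15582791, 6137543, 11332295, 5860039, 15688775, 108102, 255494, 14339143, 8334407, 16565831,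
   14534215, 7137991, 12437063, 16361031, 116294, 4056775, 15590471, 1093, 7924423, 15068231,
   12444743, 15035975, 14544391, 16567367, 15592967, 4060743, 8381511, 16114759, 14541895,
   8234567, 14478407, 7267911, 15526983, 15150663, 11365447, 16769543, 7792199, 15623751,
   12381255, 4058695, 60486, 7697991, 14575175, 11889735, 222278, 16313415, 8242759, 16606279,
   14249031, 209478, 15060551, 126470, 7202375, 16148039, 12447239, 123974, 14591559, 8186951,
   7726663, 6153799, 16573511, 16576007, 7171655, 7695431, 15558215, 7302215, 6122567, 16598599,
   7988807, 15543367, 15066695, 7138887, 6220871, 5893191, 12412487, 157254, 13493831, 14509639,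
   14476871, 7129799, 173638, 14018119, 8252935, 16623111, 12379719, 7925319, 8203335, 5875399,
   4040391, 4044359, 11904583, 12397639, 91718, 8218183, 76870, 15125575, 8348743, 14607879,
   15656455, 58950, 7303751, 14511623, 4025927, 8250439, 8185415, 16084487, 16180743, 16229895,
   15035463, 6745159, 14263879, 4058183, 16492039, 12166727, 4050503, 12174919, 7185991,
   15574087, 7173703, 16672263, 12428359, 6137415, 16688647, 7300679, 6679623, 14525511, 7194183,
   8381959, 93702, 16745991, 6145607, 14216263, 11332679, 6219335, 7972423, 14542343, 8220167,
   15003207, 16115207, 5860423, 7138375, 7171143, 15150151, 12445191, 1541, 6090311, 189958,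
   7924807, 107590, 14468679, 15151687, 239110, 15050311, 12371527, 4056647, 6155783, 3778247,
   16573959, 13477447, 3501639, 7204359, 14001735, 16589895, 8234055, 11888199, 8177223, 4025415,
   14470215, 16704007, 8178759, 3763783, 3993159, 11349063, 7201863, 124422, 13485639, 11855431,
   15557703, 50758, 5105223, 16638471, 16557127, 7693895, 12411975, 6106183, 7726151, 6153287,
   6121031, 14009927, 7136839, 8316423, 52294, 16081991, 7661127, 14509127, 14478855, 8365575,
   15524935, 12379207, 13526599, 7956039, 15527431, 15550023, 7710279, 5875271, 16049223,
   7923271, 15099463, 10284103, 11904071, 14050887, 16614919, 15002695, 8250887, 8209991,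
   8217671, 8187399, 6123015, 14525959, 4040263, 16098823, 7695879, 14263367, 12119111, 6089799,
   91206, 16360967, 8184903, 3501127, 15019079, 60934, 11363911, 4048455, 58438, 13461063,
   12428807, 3992647, 13428295, 83526, 254470, 7185479, 4062727, 11331143, 3731015, 10282567,
   5088839, 14575111, 6136903, 7128647, 11847239, 7169607, 14591495, 7652935, 16147975, 15640071,
   7267847, 5844039, 14208071, 5097031, 7792135, 7300167, 16426503, 108038, 15918599, 7130183,
   8103431, 8234503, 16557575, 5858887, 6088263, 5621319, 16630279, 10808391, 11887687, 4056135,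
   3991111, 6614087, 6153735, 14246983, 7726599, 5827655, 3778119, 13493767, 11854919, 14476807,
   15541319, 15525383, 14018055, 2944071, 4058631, 16049671, 14606855, 7138823, 10824775,
   12395591, 7693383, 15655431, 6120519, 15853063, 12379655, 6112839, 7136327, 13420103,
   14541319, 8201287, 157190, 7660615, 12444167, 14459975, 173574, 11904519, 12362823, 16671239,
   11322951, 5874759, 10274375, 16376327, 12166663, 230918, 8185351, 6080071, 8168519, 16572935,
   11363399, 16548935, 4039751, 16769031, 3982919, 3515975, 5826119, 6137351, 14517767, 15033415,
   3984455, 7915079, 58886, 7972359, 13460551, 8380935, 3728967, 11330631, 74822, 6219271,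
   10282055, 4025863, 7841287, 3786311, 15000647, 42054, 8226311, 12117063, 7161415, 16541191,
   7169095, 13477383, 6090247, 14001671, 5858375, 188934, 4023367, 14263815, 15787079, 15836679,
   123398, 5563975, 6604359, 11871303, 6907463, 3990599, 11855367, 13526535, 5105159, 14460423,
   4056583, 14533127, 3458631, 15508999, 5629447, 99846, 8315399, 12435975, 7136775, 517,
   6104135, 14050823, 11838535, 16295431, 7464455, 2935879, 8249863, 3501575, 7661063, 15115783,
   3993095, 7119943, 14329351, 8168967, 15377927, 15885831, 7906375, 7710215, 3499079, 6612039,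
   16564743, 5555783, 6129159, 13428231, 14574087, 16146951, 3466311, 11347015, 13952519,
   7398471, 4040199, 15001095, 3515463, 10282503, 5817927, 5088775, 14475783, 13492743, 11331079,
   15787527, 15524359, 8241671, 12378631, 5875207, 42502, 7152711, 16637959, 2944519, 7266823,
   3720775, 8160327, 13411399, 16310791, 10806343, 6152711, 115206, 10265671, 7987719, 5841991,
   6088199, 6644807, 5071943, 6071367, 3974215, 12173831, 2942023, 8282631, 13993479, 14444039,
   13469191, 7120391, 3991047, 7906823, 16654855, 8184327, 8152583, 3728455, 3778055, 16540167,
   2411591, 11593223, 6612487, 6144519, 156166, 33862, 7398919, 57862, 13484551, 4032007,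
   13411847, 5809223, 14984711, 12116487, 7111751, 3466759, 14198279, 10822727, 6218247,
   15246855, 5080583, 3515911, 6071815, 7758343, 14467591, 7644679, 15516167, 26118, 4055559,
   3196487, 12370439, 5104135, 253958, 7135751, 5039623, 5055559, 9741383, 7922183, 5563911,
   3974663, 13525511, 12443655, 14540807, 5022791, 8176135, 7628295, 14049799, 2925639, 3449927,
   2942471, 13427207, 16572423, 3712071, 10281479, 15000071, 11330055, 14213639, 15262215,
   4047367, 6858247, 3966023, 1895943, 14557703, 5095943, 13395463, 3712519, 12968455, 14443015,
   6185479, 12345863, 6055431, 3204615, 6087175, 49670, 12108295, 8151559, 3990023, 8380423,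
   3958279, 5023239, 7127559, 16531975, 6596103, 5809671, 7382535, 4793415, 6611463, 4760647,
   2926087, 6873607, 1893895, 122886, 8249351, 13419015, 3727879, 14991879, 10273287, 11321863,
   3433991, 2917447, 12378119, 15523847, 139782, 12960263, 3785223, 5661191, 7627271, 6078983,
   25094, 3981831, 3187783, 7889415, 5038599, 2941447, 5825031, 5531143, 6152199, 13509127,
   16539655, 6603271, 2663943, 1877511, 5, 13394439, 12902919, 10248711, 8183815, 11821575,
   14434823, 4571655, 8143367, 6054407, 3957255, 10011143, 2401799, 3171847, 11059719, 5030407,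
   5136903, 2933255, 3719687, 57350, 1892871, 7135239, 2393159, 4055047, 1615367, 3695111,
   10280967, 11329543, 14999559, 7619079, 12894727, 5530119, 12345351, 16015367, 3432967,
   5792263, 16902, 8151047, 1884679, 13386247, 12984839, 3989511, 6046215, 3949063, 6610951,
   9200135, 9724423, 2671111, 5005831, 4506119, 1860103, 3170823, 7626759, 16523271, 2940935,
   24582, 10248199, 5521927, 11821063, 15753223, 3424775, 3956743, 1597959, 1622535, 7364615,
   4997639, 1892359, 1851911, 4743687, 12328967, 8134663, 3432455, 3162631, 9199623, 9723911,
   11558919, 7872519, 1859591, 4473351, 1327623, 10231815, 3940359, 3170311, 8198, 16515079,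
   1335303, 3678215, 9183239, 1065479, 1843207, 811015, 8126471, 1581063, 3932167, 8658951,
   794631, 6, 1835015, 532487, 786439, 262151, 7]

theorem isChain_coverCountMod : (representatives.map coverCountMod).IsChain (· < ·) := by
  decide +kernel

theorem length_filter_representatives : ∀ n ∈ range 8,
    (representatives.filter (· % 8 = n)).length = graphCount n := by
  decide +kernel

theorem nodup_coverCountMod : (representatives.map coverCountMod).Nodup :=
  (List.isChain_iff_pairwise.1 isChain_coverCountMod).imp ne_of_lt

theorem eq_of_coverCount_eq {x y : ℕ} (hx : x ∈ representatives) (hy : y ∈ representatives)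
    (h : coverCount (KSF (codedGraph (x % 8) (x / 8))) =
      coverCount (KSF (codedGraph (y % 8) (y / 8)))) : x = y := by
  refine List.inj_on_of_nodup_map nodup_coverCountMod hx hy ?_
  have h' := congrArg (Int.cast : ℤ → ZMod 18446744073709551616) h
  rw [← cast_coverCountMod, ← cast_coverCountMod, ZMod.natCast_eq_natCast_iff] at h'
  exact h'.eq_of_lt_of_lt (Nat.mod_lt _ (by norm_num)) (Nat.mod_lt _ (by norm_num))

theorem exists_representative {n : ℕ} (hn : n ∈ range 8) (G : SimpleGraph (Fin n)) :
    ∃ x ∈ representatives, x % 8 = n ∧ Nonempty (G ≃g codedGraph n (x / 8)) := by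
  classical
  have : Fintype (Quotient (MulAction.orbitRel (Equiv.Perm (Fin n)) (SimpleGraph (Fin n)))) :=
    Fintype.ofFinite _
  set s := (representatives.filter (· % 8 = n)).toFinset
  let f (x : ℕ) : Quotient (MulAction.orbitRel (Equiv.Perm (Fin n)) (SimpleGraph (Fin n))) :=
    ⟦codedGraph n (x / 8)⟧
  have hs {x : ℕ} (hx : x ∈ s) : x ∈ representatives ∧ x % 8 = n := by simpa [s] using hx
  have hf : Set.InjOn f s := by
    intro x hx y hy hxy
    obtain ⟨hx, hxn⟩ := hs hx
    obtain ⟨hy, hyn⟩ := hs hy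
    obtain ⟨e⟩ := SimpleGraph.nonempty_iso_of_orbitRel (Quotient.exact hxy)
    refine eq_of_coverCount_eq hx hy ?_
    rw [hxn, hyn, KSF_eq_of_iso e]
  have hsurj : s.image f = univ := by
    refine eq_of_subset_of_card_le (subset_univ _) ?_
    rw [card_image_of_injOn hf, List.toFinset_card_of_nodup (nodup_coverCountMod.of_map.filter _),
      length_filter_representatives n hn, card_univ, ← Nat.card_eq_fintype_card]
    exact card_orbits_le hn
  obtain ⟨x, hx, hxG⟩ := mem_image.1 (hsurj.ge (mem_univ ⟦G⟧))
  exact ⟨x, (hs hx).1, (hs hx).2, SimpleGraph.nonempty_iso_of_orbitRel (Quotient.exact hxG.symm)⟩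

theorem exists_representative_of_fintype {V : Type} [Fintype V] (G : SimpleGraph V)
    (hV : Fintype.card V ≤ 7) :
    ∃ x ∈ representatives, Nonempty (G ≃g codedGraph (x % 8) (x / 8)) := by
  obtain ⟨x, hx, hn, ⟨e⟩⟩ := exists_representative (mem_range.2 (Nat.lt_succ_of_le hV))
    (G.comap (Fintype.equivFin V).symm)
  refine ⟨x, hx, ?_⟩
  rw [hn]
  exact ⟨(SimpleGraph.Iso.comap (Fintype.equivFin V).symm G).symm.trans e⟩

end Invariant

/-- Any two finite simple graphs on at most 7 vertices with the same Kromatic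
symmetric function are isomorphic. -/
theorem KSF_distinguishes_up_to_seven_vertices
    {V W : Type} [Fintype V] [Fintype W]
    (G : SimpleGraph V) (H : SimpleGraph W)
    (hV : Fintype.card V ≤ 7) (hW : Fintype.card W ≤ 7)
    (h : KSF G = KSF H) : Nonempty (G ≃g H) := by
  obtain ⟨x, hx, ⟨e⟩⟩ := exists_representative_of_fintype G hV
  obtain ⟨y, hy, ⟨e'⟩⟩ := exists_representative_of_fintype H hW
  obtain rfl : x = y := eq_of_coverCount_eq hx hy <| by
    rw [← KSF_eq_of_iso e, ← KSF_eq_of_iso e', h]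
  exact ⟨e.trans e'.symm⟩
end

section
/- Let H_1 be the tree on vertex set {1,…,7} with edges {5,1}, {5,2}, {5,3}, {5,4}, {5,6}, {6,7}, and let H_2 be the graph on vertex set {1,…,7} with edges {5,2}, {5,3}, {5,4}, {5,6}, {5,7}, {6,7}. Then H_1 and H_2 are non-isomorphic, both have independence polynomial 2x^5 + 9x^4 + 16x^3 + 15x^2 + 7x + 1, and every finite simple graph whose independence polynomial equals 2x^5 + 9x^4 + 16x^3 + 15x^2 + 7x + 1 is isomorphic to H_1 or to H_2. -/
open scoped Classical in
/-- The independence polynomial of a finite simple graph: the coefficient of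
`x^k` is the number of independent sets of vertices of size `k`. -/
noncomputable def indepPoly {V : Type} [Fintype V] (G : SimpleGraph V) :
    Polynomial ℤ :=
  ∑ S : Finset V, if ∀ u ∈ S, ∀ v ∈ S, ¬ G.Adj u v
    then Polynomial.X ^ S.card else 0

/-- The tree `H₁` on the vertices `{1, …, 7}` (encoded as `Fin 7`, with vertex
`i` encoded as `i - 1`) with edges `{5,1}, {5,2}, {5,3}, {5,4}, {5,6}, {6,7}`. -/
def H1 : SimpleGraph (Fin 7) :=
  SimpleGraph.fromEdgeSet {s(4, 0), s(4, 1), s(4, 2), s(4, 3), s(4, 5), s(5, 6)}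

/-- The graph `H₂` on the vertices `{1, …, 7}` (encoded as `Fin 7`, with vertex
`i` encoded as `i - 1`) with edges `{5,2}, {5,3}, {5,4}, {5,6}, {5,7}, {6,7}`;
vertex `1` is isolated. -/
def H2 : SimpleGraph (Fin 7) :=
  SimpleGraph.fromEdgeSet {s(4, 1), s(4, 2), s(4, 3), s(4, 5), s(4, 6), s(5, 6)}

open scoped Classical in
/-- The independent sets of vertices of size `k`. -/
noncomputable def indepSetsOfCard {V : Type} [Fintype V] (G : SimpleGraph V) (k : ℕ) :
    Finset (Finset V) :=
  {S | S.card = k ∧ ∀ u ∈ S, ∀ v ∈ S, ¬ G.Adj u v}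

theorem mem_indepSetsOfCard {V : Type} [Fintype V] {G : SimpleGraph V} {k : ℕ} {S : Finset V} :
    S ∈ indepSetsOfCard G k ↔ S.card = k ∧ ∀ u ∈ S, ∀ v ∈ S, ¬ G.Adj u v := by
  simp [indepSetsOfCard]

theorem indepPoly_coeff {V : Type} [Fintype V] (G : SimpleGraph V) (k : ℕ) :
    (indepPoly G).coeff k = (indepSetsOfCard G k).card := by
  classical
  rw [indepPoly, Polynomial.finsetSum_coeff, indepSetsOfCard, Finset.card_filter]
  push_cast
  refine Finset.sum_congr rfl fun S _ => ?_
  by_cases h : ∀ u ∈ S, ∀ v ∈ S, ¬ G.Adj u v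
  · rw [if_pos h, Polynomial.coeff_X_pow]
    exact if_congr (by simp only [eq_comm, and_iff_left h]) rfl rfl
  · rw [if_neg h, if_neg fun h' => h h'.2, Polynomial.coeff_zero]

theorem card_indepSetsOfCard_eq_of_iso {V W : Type} [Fintype V] [Fintype W]
    {G : SimpleGraph V} {H : SimpleGraph W} (e : G ≃g H) (k : ℕ) :
    (indepSetsOfCard G k).card = (indepSetsOfCard H k).card := by
  refine Finset.card_equiv (Equiv.finsetCongr e.toEquiv) fun S => ?_
  simp only [mem_indepSetsOfCard, Equiv.finsetCongr_apply, Finset.card_map,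
    Finset.forall_mem_map]
  refine and_congr_right fun _ => ?_
  exact forall₂_congr fun u _ => forall₂_congr fun v _ => e.map_adj_iff.symm.not

theorem indepPoly_eq_sum {V : Type} [Fintype V] (G : SimpleGraph V) :
    indepPoly G = ∑ k ∈ Finset.range (Fintype.card V + 1),
      Polynomial.C ((indepSetsOfCard G k).card : ℤ) * Polynomial.X ^ k := by
  ext n
  simp only [Polynomial.finsetSum_coeff, Polynomial.coeff_C_mul_X_pow, Finset.sum_ite_eq,
    Finset.mem_range, indepPoly_coeff]
  split_ifs with h
  · rfl
  · rw [Nat.cast_eq_zero, Finset.card_eq_zero, Finset.eq_empty_iff_forall_notMem]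
    intro S hS
    have := (mem_indepSetsOfCard.1 hS).1
    have := S.card_le_univ
    omega

theorem card_indepSetsOfCard_eq_card_filter {V : Type} [Fintype V] [DecidableEq V]
    (G : SimpleGraph V) [DecidableRel G.Adj] (k : ℕ) :
    (indepSetsOfCard G k).card =
      ((Finset.univ : Finset (Finset V)).filter
        fun S => S.card = k ∧ ∀ u ∈ S, ∀ v ∈ S, ¬ G.Adj u v).card := by
  refine congrArg Finset.card (Finset.ext fun S => ?_)
  simp [mem_indepSetsOfCard]

instance : DecidableRel H1.Adj := fun a b =>
  decidable_of_iff (s(a, b) ∈ ({s(4, 0), s(4, 1), s(4, 2), s(4, 3), s(4, 5), s(5, 6)} :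
    Finset (Sym2 (Fin 7))) ∧ a ≠ b) (by simp [H1])

instance : DecidableRel H2.Adj := fun a b =>
  decidable_of_iff (s(a, b) ∈ ({s(4, 1), s(4, 2), s(4, 3), s(4, 5), s(4, 6), s(5, 6)} :
    Finset (Sym2 (Fin 7))) ∧ a ≠ b) (by simp [H2])

/-- The coefficients of the common independence polynomial of `H₁` and `H₂`. -/
def commonCoeff : Fin 8 → ℕ := ![1, 7, 15, 16, 9, 2, 0, 0]

theorem indepPoly_eq_of_card {G : SimpleGraph (Fin 7)}
    (h : ∀ k : Fin 8, (indepSetsOfCard G k).card = commonCoeff k) :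
    indepPoly G = 2 * Polynomial.X ^ 5 + 9 * Polynomial.X ^ 4
        + 16 * Polynomial.X ^ 3 + 15 * Polynomial.X ^ 2 + 7 * Polynomial.X + 1 := by
  have h₀ : (indepSetsOfCard G 0).card = 1 := h 0
  have h₁ : (indepSetsOfCard G 1).card = 7 := h 1
  have h₂ : (indepSetsOfCard G 2).card = 15 := h 2
  have h₃ : (indepSetsOfCard G 3).card = 16 := h 3
  have h₄ : (indepSetsOfCard G 4).card = 9 := h 4
  have h₅ : (indepSetsOfCard G 5).card = 2 := h 5
  have h₆ : (indepSetsOfCard G 6).card = 0 := h 6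
  have h₇ : (indepSetsOfCard G 7).card = 0 := h 7
  rw [indepPoly_eq_sum, Fintype.card_fin]
  simp only [Finset.sum_range_succ, Finset.sum_range_zero, h₀, h₁, h₂, h₃, h₄, h₅, h₆, h₇]
  simp only [Nat.cast_ofNat, Nat.cast_zero, Nat.cast_one, map_ofNat, map_zero, map_one]
  ring

theorem indepPoly_H1 : indepPoly H1 = 2 * Polynomial.X ^ 5 + 9 * Polynomial.X ^ 4
    + 16 * Polynomial.X ^ 3 + 15 * Polynomial.X ^ 2 + 7 * Polynomial.X + 1 := by
  refine indepPoly_eq_of_card fun k => ?_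
  rw [card_indepSetsOfCard_eq_card_filter]
  revert k
  decide +kernel

theorem indepPoly_H2 : indepPoly H2 = 2 * Polynomial.X ^ 5 + 9 * Polynomial.X ^ 4
    + 16 * Polynomial.X ^ 3 + 15 * Polynomial.X ^ 2 + 7 * Polynomial.X + 1 := by
  refine indepPoly_eq_of_card fun k => ?_
  rw [card_indepSetsOfCard_eq_card_filter]
  revert k
  decide +kernel

theorem not_nonempty_H1_iso_H2 : ¬ Nonempty (H1 ≃g H2) := by
  rintro ⟨e⟩
  have no_isolated : ∀ v, ∃ w, H1.Adj v w := by decide +kernel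
  have isolated : ∀ w, ¬ H2.Adj 0 w := by decide +kernel
  obtain ⟨w, hw⟩ := no_isolated (e.symm 0)
  refine isolated (e w) ?_
  simpa using e.map_adj_iff.2 hw

theorem card_indepSetsOfCard_two (G : SimpleGraph (Fin 7)) [DecidableRel G.Adj] :
    (indepSetsOfCard G 2).card =
      ∑ j : Fin 7, ∑ i : Fin 7, if i < j then (if G.Adj i j then 0 else 1) else 0 := by
  have pairs : (Finset.univ.filter fun p : Fin 7 × Fin 7 => p.1 < p.2 ∧ ¬ G.Adj p.1 p.2).card =
      (indepSetsOfCard G 2).card := by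
    refine Finset.card_bij (fun p _ => {p.1, p.2}) ?_ ?_ ?_
    · rintro ⟨i, j⟩ h
      simp only [Finset.mem_filter, Finset.mem_univ, true_and] at h
      simp [mem_indepSetsOfCard, Finset.card_pair h.1.ne, h.2, G.adj_comm j i]
    · rintro ⟨i, j⟩ h ⟨i', j'⟩ h' e
      simp only [Finset.mem_filter, Finset.mem_univ, true_and] at h h'
      replace h := h.1
      replace h' := h'.1
      revert i j i' j'
      decide +kernel
    · intro S hS
      obtain ⟨hc, hS⟩ := mem_indepSetsOfCard.1 hS
      obtain ⟨i, j, hij, rfl⟩ := Finset.card_eq_two.1 hc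
      have nadj : ¬ G.Adj i j := hS i (by simp) j (by simp)
      rcases hij.lt_or_gt with h | h
      · exact ⟨(i, j), by simp [h, nadj], rfl⟩
      · exact ⟨(j, i), by simp [h, nadj, G.adj_comm j i], Finset.pair_comm _ _⟩
  rw [← pairs, Finset.card_filter, Fintype.sum_prod_type_right]
  refine Finset.sum_congr rfl fun j _ => Finset.sum_congr rfl fun i _ => ?_
  split_ifs <;> simp_all

/-- An injective family of `7` vertices of a graph of order `7` relabels the graph. -/
theorem exists_iso_comap {V : Type} [Fintype V] (G : SimpleGraph V) (hV : Fintype.card V = 7)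
    (f : Fin 7 → V) (hf : Function.Injective f) : Nonempty (G.comap f ≃g G) :=
  ⟨⟨Equiv.ofBijective f ((Fintype.bijective_iff_injective_and_card f).2 ⟨hf, by simp [hV]⟩),
    by simp⟩⟩

/-- Two `5`-sets in a set of size `7` can be put in one of two standard positions. -/
theorem exists_labelling {V : Type} [Fintype V] (hV : Fintype.card V = 7) {A B : Finset V}
    (hA : A.card = 5) (hB : B.card = 5) (hAB : A ≠ B) :
    ∃ f : Fin 7 → V, Function.Injective f ∧ (∀ i ∈ ({0, 1, 2, 3, 4} : Finset (Fin 7)), f i ∈ A) ∧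
      ((∀ i ∈ ({0, 1, 2, 3, 5} : Finset (Fin 7)), f i ∈ B) ∨
        ∀ i ∈ ({0, 1, 2, 5, 6} : Finset (Fin 7)), f i ∈ B) := by
  classical
  have labelling : ∀ {n : ℕ} (S : Finset V), S.card = n →
      ∃ g : Fin n → V, Function.Injective g ∧ ∀ i, g i ∈ S := fun S hS =>
    ⟨fun i => (S.equivFinOfCardEq hS).symm i,
      Subtype.val_injective.comp (Equiv.injective _), fun i => Subtype.property _⟩
  have h₁ := Finset.card_inter_add_card_sdiff A B
  have h₂ := Finset.card_inter_add_card_sdiff B A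
  rw [Finset.inter_comm B A] at h₂
  have h₃ := Finset.card_union_add_card_inter A B
  have h₄ := Finset.card_add_card_compl (A ∪ B)
  have h₅ : (A ∩ B).card ≠ 5 := fun h => hAB <|
    (Finset.eq_of_subset_of_card_le Finset.inter_subset_left (by omega)).symm.trans
      (Finset.eq_of_subset_of_card_le Finset.inter_subset_right (by omega))
  have h₆ : (A ∩ B).card = 4 ∨ (A ∩ B).card = 3 := by omega
  rcases h₆ with h | h
  · obtain ⟨c, hc, hcm⟩ := labelling (n := 4) (A ∩ B) h
    obtain ⟨a, -, ham⟩ := labelling (n := 1) (A \ B) (by omega)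
    obtain ⟨b, -, hbm⟩ := labelling (n := 1) (B \ A) (by omega)
    obtain ⟨w, -, hwm⟩ := labelling (n := 1) (A ∪ B)ᶜ (by omega)
    refine ⟨![c 0, c 1, c 2, c 3, a 0, b 0, w 0], ?_, ?_, Or.inl ?_⟩
    · rw [← List.nodup_ofFn]
      simp only [Finset.mem_inter, Finset.mem_sdiff, Finset.mem_compl, Finset.mem_union]
        at hcm ham hbm hwm
      clear labelling h₁ h₂ h₃ h₄
      simp [hc.eq_iff]
      grind (splits := 40)
    · simp_all
    · simp_all
  · obtain ⟨c, hc, hcm⟩ := labelling (n := 3) (A ∩ B) h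
    obtain ⟨a, ha, ham⟩ := labelling (n := 2) (A \ B) (by omega)
    obtain ⟨b, hb, hbm⟩ := labelling (n := 2) (B \ A) (by omega)
    refine ⟨![c 0, c 1, c 2, a 0, a 1, b 0, b 1], ?_, ?_, Or.inr ?_⟩
    · rw [← List.nodup_ofFn]
      simp only [Finset.mem_inter, Finset.mem_sdiff] at hcm ham hbm
      clear labelling h₁ h₂ h₃ h₄
      simp [hc.eq_iff, ha.eq_iff, hb.eq_iff]
      grind (splits := 40)
    · simp_all
    · simp_all

/-- The graph on seven vertices with the edge `{4, 5}` in which `6` is adjacent to every other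
vertex except possibly `k`. -/
def almostCone (k : Fin 7) : SimpleGraph (Fin 7) where
  Adj i j := i ≠ j ∧ (i = 6 ∧ j ≠ k ∨ j = 6 ∧ i ≠ k ∨ i = 4 ∧ j = 5 ∨ i = 5 ∧ j = 4)
  symm := ⟨fun i j => by tauto⟩
  loopless := ⟨fun i => by tauto⟩

instance (k : Fin 7) : DecidableRel (almostCone k).Adj := fun i j =>
  inferInstanceAs (Decidable (i ≠ j ∧
    (i = 6 ∧ j ≠ k ∨ j = 6 ∧ i ≠ k ∨ i = 4 ∧ j = 5 ∨ i = 5 ∧ j = 4)))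

theorem almostCone_iso {k : Fin 7} (hk : k < 6) :
    Nonempty (almostCone k ≃g H1) ∨ Nonempty (almostCone k ≃g H2) := by
  have iso_of_comp : ∀ {H : SimpleGraph (Fin 7)} (g h : Fin 7 → Fin 7),
      Function.LeftInverse h g → Function.RightInverse h g →
      (∀ i j, H.Adj (g i) (g j) ↔ (almostCone k).Adj i j) → Nonempty (almostCone k ≃g H) :=
    fun g h hl hr hH => ⟨⟨⟨g, h, hl, hr⟩, hH _ _⟩⟩
  have cases_k : k = 0 ∨ k = 1 ∨ k = 2 ∨ k = 3 ∨ k = 4 ∨ k = 5 := by omega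
  rcases cases_k with rfl | rfl | rfl | rfl | rfl | rfl
  · exact Or.inr (iso_of_comp ![0, 1, 2, 3, 5, 6, 4] ![0, 1, 2, 3, 6, 4, 5]
      (by decide +kernel) (by decide +kernel) (by decide +kernel))
  · exact Or.inr (iso_of_comp ![1, 0, 2, 3, 5, 6, 4] ![1, 0, 2, 3, 6, 4, 5]
      (by decide +kernel) (by decide +kernel) (by decide +kernel))
  · exact Or.inr (iso_of_comp ![2, 1, 0, 3, 5, 6, 4] ![2, 1, 0, 3, 6, 4, 5]
      (by decide +kernel) (by decide +kernel) (by decide +kernel))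
  · exact Or.inr (iso_of_comp ![3, 1, 2, 0, 5, 6, 4] ![3, 1, 2, 0, 6, 4, 5]
      (by decide +kernel) (by decide +kernel) (by decide +kernel))
  · exact Or.inl (iso_of_comp ![0, 1, 2, 3, 6, 5, 4] ![0, 1, 2, 3, 6, 5, 4]
      (by decide +kernel) (by decide +kernel) (by decide +kernel))
  · exact Or.inl (iso_of_comp ![0, 1, 2, 3, 5, 6, 4] ![0, 1, 2, 3, 6, 4, 5]
      (by decide +kernel) (by decide +kernel) (by decide +kernel))

theorem iso_H1_or_H2_of_standard_position {G : SimpleGraph (Fin 7)} (h₂ : (indepSetsOfCard G 2).card = 15)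
    (h₆ : (indepSetsOfCard G 6).card = 0)
    (hA : ∀ i ∈ ({0, 1, 2, 3, 4} : Finset (Fin 7)), ∀ j ∈ ({0, 1, 2, 3, 4} : Finset (Fin 7)),
      ¬ G.Adj i j)
    (hB : (∀ i ∈ ({0, 1, 2, 3, 5} : Finset (Fin 7)), ∀ j ∈ ({0, 1, 2, 3, 5} : Finset (Fin 7)),
      ¬ G.Adj i j) ∨ ∀ i ∈ ({0, 1, 2, 5, 6} : Finset (Fin 7)),
        ∀ j ∈ ({0, 1, 2, 5, 6} : Finset (Fin 7)), ¬ G.Adj i j) :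
    Nonempty (G ≃g H1) ∨ Nonempty (G ≃g H2) := by
  classical
  rw [card_indepSetsOfCard_two] at h₂
  simp only [Finset.mem_insert, Finset.mem_singleton, forall_eq_or_imp, forall_eq] at hA hB
  simp [Fin.sum_univ_seven, hA] at h₂
  rcases hB with hB | hB
  · simp [hB] at h₂
    have adj45 : G.Adj 4 5 := by
      by_contra h
      rw [Finset.card_eq_zero] at h₆
      have : ({0, 1, 2, 3, 4, 5} : Finset (Fin 7)) ∈ indepSetsOfCard G 6 := by
        rw [mem_indepSetsOfCard]
        refine ⟨rfl, ?_⟩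
        simp [hA, hB, h, G.adj_comm 5 4]
      simp [h₆] at this
    have one_missing : (Finset.univ.filter fun i : Fin 7 => i < 6 ∧ ¬ G.Adj i 6).card = 1 := by
      rw [Finset.card_filter, Fin.sum_univ_seven]
      simp [adj45] at h₂
      simp
      grind
    obtain ⟨k, hk⟩ := Finset.card_eq_one.1 one_missing
    have adj_iff : ∀ i : Fin 7, i < 6 ∧ ¬ G.Adj i 6 ↔ i = k := fun i => by
      simpa using Finset.ext_iff.1 hk i
    have G_eq : G = almostCone k := by
      have adj_iff_of_lt : ∀ i j, i < j → (G.Adj i j ↔ (almostCone k).Adj i j) := by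
        intro i j hij
        by_cases hj : j = 6
        · subst hj
          have := adj_iff i
          simp only [almostCone]
          grind
        · have : j < 6 := by omega
          clear adj_iff hk h₂
          revert hij
          fin_cases j <;> fin_cases i <;> simp_all [almostCone]
      ext i j
      rcases lt_trichotomy i j with h | rfl | h
      · exact adj_iff_of_lt i j h
      · simp
      · rw [G.adj_comm, (almostCone k).adj_comm, adj_iff_of_lt j i h]
    rw [G_eq]
    exact almostCone_iso ((adj_iff k).2 rfl).1
  · simp [hB] at h₂
    grind

theorem iso_H1_or_H2_of_card {V : Type} [Fintype V] {G : SimpleGraph V}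
    (hV : Fintype.card V = 7) (h₂ : (indepSetsOfCard G 2).card = 15)
    (h₅ : (indepSetsOfCard G 5).card = 2) (h₆ : (indepSetsOfCard G 6).card = 0) :
    Nonempty (G ≃g H1) ∨ Nonempty (G ≃g H2) := by
  classical
  obtain ⟨A, B, hAB, hS⟩ := Finset.card_eq_two.1 h₅
  obtain ⟨hA, hA'⟩ := mem_indepSetsOfCard.1 (show A ∈ indepSetsOfCard G 5 by simp [hS])
  obtain ⟨hB, hB'⟩ := mem_indepSetsOfCard.1 (show B ∈ indepSetsOfCard G 5 by simp [hS])
  obtain ⟨f, hf, hfA, hfB⟩ := exists_labelling hV hA hB hAB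
  obtain ⟨e⟩ := exists_iso_comap G hV f hf
  have key := iso_H1_or_H2_of_standard_position (G := G.comap f)
    ((card_indepSetsOfCard_eq_of_iso e 2).trans h₂)
    ((card_indepSetsOfCard_eq_of_iso e 6).trans h₆)
    (fun i hi j hj => hA' _ (hfA i hi) _ (hfA j hj))
    (hfB.imp (fun h i hi j hj => hB' _ (h i hi) _ (h j hj))
      fun h i hi j hj => hB' _ (h i hi) _ (h j hj))
  exact key.imp (fun ⟨g⟩ => ⟨e.symm.trans g⟩) fun ⟨g⟩ => ⟨e.symm.trans g⟩

theorem card_indepSetsOfCard_one {V : Type} [Fintype V] (G : SimpleGraph V) :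
    (indepSetsOfCard G 1).card = Fintype.card V := by
  rw [← Finset.card_univ]
  symm
  refine Finset.card_bij (fun v _ => {v}) (fun v _ => by simp [mem_indepSetsOfCard])
    (fun v _ w _ h => Finset.singleton_injective h) fun S hS => ?_
  obtain ⟨v, rfl⟩ := Finset.card_eq_one.1 (mem_indepSetsOfCard.1 hS).1
  exact ⟨v, by simp, rfl⟩

/-- `H₁` and `H₂` are non-isomorphic, both have independence polynomial
`2x⁵ + 9x⁴ + 16x³ + 15x² + 7x + 1`, and every finite simple graph with this
independence polynomial is isomorphic to `H₁` or to `H₂`. -/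
theorem H1_H2_independence_unique_pair :
    ¬ Nonempty (H1 ≃g H2)
    ∧ indepPoly H1 = 2 * Polynomial.X ^ 5 + 9 * Polynomial.X ^ 4
        + 16 * Polynomial.X ^ 3 + 15 * Polynomial.X ^ 2 + 7 * Polynomial.X + 1
    ∧ indepPoly H2 = 2 * Polynomial.X ^ 5 + 9 * Polynomial.X ^ 4
        + 16 * Polynomial.X ^ 3 + 15 * Polynomial.X ^ 2 + 7 * Polynomial.X + 1
    ∧ ∀ (V : Type) [Fintype V] (G : SimpleGraph V),
        indepPoly G = 2 * Polynomial.X ^ 5 + 9 * Polynomial.X ^ 4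
          + 16 * Polynomial.X ^ 3 + 15 * Polynomial.X ^ 2 + 7 * Polynomial.X + 1
        → Nonempty (G ≃g H1) ∨ Nonempty (G ≃g H2) := by
  refine ⟨not_nonempty_H1_iso_H2, indepPoly_H1, indepPoly_H2, fun V _ G hG => ?_⟩
  have coeff_eq : ∀ k, ((indepSetsOfCard G k).card : ℤ) = (indepSetsOfCard H1 k).card := fun k => by
    rw [← indepPoly_coeff, ← indepPoly_coeff, hG, indepPoly_H1]
  have card_eq : ∀ k : Fin 8, (indepSetsOfCard G k).card = commonCoeff k := by
    intro k
    rw [Nat.cast_injective (coeff_eq k), card_indepSetsOfCard_eq_card_filter]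
    revert k
    decide +kernel
  exact iso_H1_or_H2_of_card ((card_indepSetsOfCard_one G).symm.trans (card_eq 1))
    (card_eq 2) (card_eq 5) (card_eq 6)
end
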